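/- Consider an n-player normal-form game with strictly positive utilities in which every strategy set S_i has m_i = |S_i| ≥ 2 elements, and let α ≥ 1. If p* is a generalized equilibrium at selfishness level α, then for every player i, 0 ≤ max_{x_i ∈ S_i} u_i(x_i, p*_{-i}) − Σ_{x_i ∈ S_i} u_i(x_i, p*_{-i}) p*_i(x_i) < ((m_i − 1)/e) · (max_{x_i ∈ S_i} u_i(x_i, p*_{-i})) · α^{-1}; that is, each player's expected payoff at the generalized equilibrium is within a factor of order 1/α of his best-response payoff. -/

import Mathlib

open Finset

/-- `p` is a (mixed) strategy profile: each `p i` is a probability distribution on `S i`. -/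
def IsProfile {n : ℕ} {S : Fin n → Type*} [∀ i, Fintype (S i)]
    (p : ∀ i, S i → ℝ) : Prop :=
  (∀ i a, 0 ≤ p i a) ∧ ∀ i, ∑ a, p i a = 1

/-- The action payoff `u_i(a, p_{-i})` of action `a` of player `i` against profile `p`. -/
noncomputable def actionPayoff {n : ℕ} {S : Fin n → Type*} [∀ i, Fintype (S i)]
    [∀ i, DecidableEq (S i)]
    (u : ∀ _ : Fin n, (∀ j, S j) → ℝ) (p : ∀ i, S i → ℝ) (i : Fin n) (a : S i) : ℝ :=
  ∑ x : ∀ j, S j, if x i = a then u i x * ∏ j ∈ univ.erase i, p j (x j) else 0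

/-- `p` is a generalized equilibrium at selfishness level `α`. -/
def IsGenEquilibrium {n : ℕ} {S : Fin n → Type*} [∀ i, Fintype (S i)]
    [∀ i, DecidableEq (S i)]
    (u : ∀ _ : Fin n, (∀ j, S j) → ℝ) (α : ℝ) (p : ∀ i, S i → ℝ) : Prop :=
  IsProfile p ∧ ∀ i (a : S i),
    p i a = actionPayoff u p i a ^ α / ∑ b, actionPayoff u p i b ^ α

theorem one_sub_mul_rpow_lt {t α : ℝ} (ht : 0 < t) (ht1 : t ≤ 1) (hα : 0 < α) :
    (1 - t) * t ^ α < 1 / Real.exp 1 * α⁻¹ := by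
  rcases ht1.eq_or_lt with rfl | hlt
  · simp only [sub_self, zero_mul]
    positivity
  · have hpow : t ^ α < Real.exp (-(α * (1 - t))) := by
      rw [Real.rpow_def_of_pos ht, Real.exp_lt_exp]
      nlinarith [Real.log_lt_sub_one_of_pos ht hlt.ne]
    have hexp : α * (1 - t) ≤ Real.exp (α * (1 - t) - 1) := by
      linarith [Real.add_one_le_exp (α * (1 - t) - 1)]
    have hmul : α * (1 - t) * t ^ α < 1 / Real.exp 1 := by
      calc α * (1 - t) * t ^ α
          < α * (1 - t) * Real.exp (-(α * (1 - t))) :=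
            mul_lt_mul_of_pos_left hpow (mul_pos hα (sub_pos.2 hlt))
        _ ≤ Real.exp (α * (1 - t) - 1) * Real.exp (-(α * (1 - t))) := by gcongr
        _ = 1 / Real.exp 1 := by
            rw [← Real.exp_add, one_div, ← Real.exp_neg]
            ring_nf
    rw [← div_eq_mul_inv, lt_div_iff₀ hα]
    linarith

/-- The gap contributed by a value `v a` to the `rpow`-weighted average of a positive family
bounded by one of its members `v b`. -/
theorem sub_mul_rpow_div_sum_lt {ι : Type*} [Fintype ι] {v : ι → ℝ} (hv : ∀ a, 0 < v a)
    {α : ℝ} (hα : 0 < α) {a b : ι} (hab : v a ≤ v b) :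
    (v b - v a) * (v a ^ α / ∑ c, v c ^ α) < 1 / Real.exp 1 * v b * α⁻¹ := by
  have hle : v a ^ α / ∑ c, v c ^ α ≤ (v a / v b) ^ α := by
    rw [Real.div_rpow (hv a).le (hv b).le]
    have hb := Real.rpow_pos_of_pos (hv b) α
    have ha := Real.rpow_pos_of_pos (hv a) α
    gcongr
    exact single_le_sum (f := fun c => v c ^ α)
      (fun c _ => (Real.rpow_pos_of_pos (hv c) α).le) (mem_univ b)
  have hlt := one_sub_mul_rpow_lt (div_pos (hv a) (hv b)) ((div_le_one (hv b)).2 hab) hα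
  calc (v b - v a) * (v a ^ α / ∑ c, v c ^ α)
      ≤ (v b - v a) * (v a / v b) ^ α :=
        mul_le_mul_of_nonneg_left hle (sub_nonneg.2 hab)
    _ = v b * ((1 - v a / v b) * (v a / v b) ^ α) := by
        rw [← mul_assoc, mul_sub, mul_one, mul_div_cancel₀ _ (hv b).ne']
    _ < v b * (1 / Real.exp 1 * α⁻¹) := mul_lt_mul_of_pos_left hlt (hv b)
    _ = 1 / Real.exp 1 * v b * α⁻¹ := by ring

theorem IsProfile.actionPayoff_pos {n : ℕ} {S : Fin n → Type*} [∀ i, Fintype (S i)]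
    [∀ i, DecidableEq (S i)] {u : ∀ _ : Fin n, (∀ j, S j) → ℝ} (hu : ∀ i x, 0 < u i x)
    {p : ∀ i, S i → ℝ} (hp : IsProfile p) (i : Fin n) (a : S i) :
    0 < actionPayoff u p i a := by
  have hex : ∀ j, ∃ b, 0 < p j b := fun j => by
    obtain ⟨b, -, hb⟩ := exists_lt_of_sum_lt (s := univ) (f := fun _ => (0 : ℝ)) (g := p j)
      (by simp [hp.2 j])
    exact ⟨b, hb⟩
  choose b hb using hex
  refine sum_pos' (fun x _ => ?_) ⟨Function.update b i a, mem_univ _, ?_⟩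
  · split_ifs
    · exact mul_nonneg (hu i x).le (prod_nonneg fun j _ => hp.1 j (x j))
    · exact le_rfl
  · rw [if_pos (Function.update_self i a b)]
    refine mul_pos (hu i _) (prod_pos fun j hj => ?_)
    rw [Function.update_of_ne (ne_of_mem_erase hj)]
    exact hb j

/-- At a generalized equilibrium with level `α ≥ 1` and `m_i ≥ 2` actions per player,
each player's expected payoff is within `((m_i−1)/e)·(max payoff)·α⁻¹` of his
best-response payoff. -/
theorem genEquilibrium_payoff_gap_bound
    {n : ℕ} {S : Fin n → Type*} [∀ i, Fintype (S i)] [∀ i, Nonempty (S i)]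
    [∀ i, DecidableEq (S i)]
    (hcard : ∀ i, 2 ≤ Fintype.card (S i))
    (u : ∀ _ : Fin n, (∀ j, S j) → ℝ) (hu : ∀ i x, 0 < u i x)
    (α : ℝ) (hα : 1 ≤ α)
    (p : ∀ i, S i → ℝ) (hp : IsGenEquilibrium u α p) :
    ∀ i : Fin n,
      0 ≤ univ.sup' univ_nonempty (actionPayoff u p i)
            - ∑ a, actionPayoff u p i a * p i a ∧
      univ.sup' univ_nonempty (actionPayoff u p i)
            - ∑ a, actionPayoff u p i a * p i a
        < ((Fintype.card (S i) : ℝ) - 1) / Real.exp 1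
            * univ.sup' univ_nonempty (actionPayoff u p i) * α⁻¹ := by
  intro i
  obtain ⟨hprof, heq⟩ := hp
  have hv := hprof.actionPayoff_pos hu i
  obtain ⟨b, -, hb⟩ := exists_mem_eq_sup' univ_nonempty (actionPayoff u p i)
  have hle : ∀ a, actionPayoff u p i a ≤ actionPayoff u p i b := fun a =>
    hb ▸ le_sup' (actionPayoff u p i) (mem_univ a)
  rw [hb]
  have hgap : actionPayoff u p i b - ∑ a, actionPayoff u p i a * p i a
      = ∑ a, (actionPayoff u p i b - actionPayoff u p i a) * p i a := by
    simp only [sub_mul, sum_sub_distrib, ← mul_sum, hprof.2 i, mul_one]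
  rw [hgap]
  refine ⟨sum_nonneg fun a _ => mul_nonneg (sub_nonneg.2 (hle a)) (hprof.1 i a), ?_⟩
  have hcard_erase : (univ.erase b).card = Fintype.card (S i) - 1 := by
    rw [card_erase_of_mem (mem_univ b), card_univ]
  have hne : (univ.erase b).Nonempty := by
    rw [← card_pos, hcard_erase]
    have := hcard i
    omega
  rw [← add_sum_erase _ _ (mem_univ b), sub_self, zero_mul, zero_add]
  calc ∑ a ∈ univ.erase b, (actionPayoff u p i b - actionPayoff u p i a) * p i a
      < ∑ _a ∈ univ.erase b, 1 / Real.exp 1 * actionPayoff u p i b * α⁻¹ := by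
        refine sum_lt_sum_of_nonempty hne fun a _ => ?_
        rw [heq i a]
        exact sub_mul_rpow_div_sum_lt hv (by linarith) (hle a)
    _ = ((Fintype.card (S i) : ℝ) - 1) / Real.exp 1 * actionPayoff u p i b * α⁻¹ := by
        rw [sum_const, hcard_erase, nsmul_eq_mul, Nat.cast_sub (by linarith [hcard i]),
          Nat.cast_one]
        ring
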